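/- A positional MAX strategy σ of an SSG is optimal if and only if its switch set S_σ is empty. -/

import Mathlib

open scoped BigOperators

instance : Fact ((0:ℝ) ≤ 1) := ⟨zero_le_one⟩

/-- A simple stochastic game on a finite vertex set `V`. -/
structure SSG (V : Type*) [Fintype V] [DecidableEq V] where
  /-- MAX vertices -/
  VMax : Finset V
  /-- MIN vertices -/
  VMin : Finset V
  /-- random vertices -/
  VR : Finset V
  /-- sink vertices -/
  VS : Finset V
  cover : ∀ x : V, x ∈ VMax ∨ x ∈ VMin ∨ x ∈ VR ∨ x ∈ VS
  disjMaxMin : Disjoint VMax VMin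
  disjMaxR : Disjoint VMax VR
  disjMaxS : Disjoint VMax VS
  disjMinR : Disjoint VMin VR
  disjMinS : Disjoint VMin VS
  disjRS : Disjoint VR VS
  /-- out-neighbourhood: `y ∈ succ x` iff `(x,y)` is an edge -/
  succ : V → Finset V
  outMax : ∀ x ∈ VMax, 2 ≤ (succ x).card
  outMin : ∀ x ∈ VMin, 2 ≤ (succ x).card
  outR : ∀ x ∈ VR, 1 ≤ (succ x).card
  /-- transition probabilities at random vertices -/
  prob : V → V → ℝ
  prob_nonneg : ∀ x y, 0 ≤ prob x y
  prob_support : ∀ x ∈ VR, ∀ y, y ∉ succ x → prob x y = 0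
  prob_sum : ∀ x ∈ VR, (∑ y, prob x y) = 1
  /-- values of the sinks -/
  val : V → ℝ
  val_mem : ∀ x ∈ VS, val x ∈ Set.Icc (0:ℝ) 1

namespace SSG

variable {V : Type*} [Fintype V] [DecidableEq V]

/-- A positional MAX strategy: a choice of an out-neighbour at every MAX vertex
(normalised to the identity away from `VMax`). -/
structure MaxStrategy (G : SSG V) where
  toFun : V → V
  mem_succ : ∀ x ∈ G.VMax, toFun x ∈ G.succ x
  eq_id : ∀ x ∉ G.VMax, toFun x = x

/-- A positional MIN strategy. -/
structure MinStrategy (G : SSG V) where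
  toFun : V → V
  mem_succ : ∀ x ∈ G.VMin, toFun x ∈ G.succ x
  eq_id : ∀ x ∉ G.VMin, toFun x = x

/-- The one-step (monotone) operator on value vectors associated with `(σ,τ)`. -/
noncomputable def F (G : SSG V) (σ : G.MaxStrategy) (τ : G.MinStrategy)
    (w : V → unitInterval) (x : V) : unitInterval :=
  if _hM : x ∈ G.VMax then w (σ.toFun x)
  else if _hN : x ∈ G.VMin then w (τ.toFun x)
  else if hR : x ∈ G.VR then
    ⟨∑ y, G.prob x y * (w y : ℝ), by
      constructor
      · exact Finset.sum_nonneg fun y _ =>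
          mul_nonneg (G.prob_nonneg x y) (w y).2.1
      · calc (∑ y, G.prob x y * (w y : ℝ)) ≤ ∑ y, G.prob x y :=
              Finset.sum_le_sum fun y _ =>
                mul_le_of_le_one_right (G.prob_nonneg x y) (w y).2.2
          _ = 1 := G.prob_sum x hR⟩
  else ⟨G.val x, G.val_mem x (by
    rcases G.cover x with h | h | h | h
    · exact absurd h _hM
    · exact absurd h _hN
    · exact absurd h hR
    · exact h)⟩

/-- The value vector `v_{σ,τ}`: the least fixed point (à la Knaster–Tarski) of `F`. -/
noncomputable def value (G : SSG V) (σ : G.MaxStrategy) (τ : G.MinStrategy) :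
    V → unitInterval :=
  sInf {w : V → unitInterval | G.F σ τ w ≤ w}

/-- `τ` is a best response to `σ`. -/
def IsBestResponse (G : SSG V) (σ : G.MaxStrategy) (τ : G.MinStrategy) : Prop :=
  ∀ τ' : G.MinStrategy, G.value σ τ ≤ G.value σ τ'

/-- `σ` is an optimal MAX strategy: `v_σ ≥ v_{σ'}` for every MAX strategy `σ'`
(values being computed against best responses). -/
def IsOptimal (G : SSG V) (σ : G.MaxStrategy) : Prop :=
  ∀ τ : G.MinStrategy, G.IsBestResponse σ τ →
    ∀ σ' : G.MaxStrategy, ∀ τ' : G.MinStrategy, G.IsBestResponse σ' τ' →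
      G.value σ' τ' ≤ G.value σ τ

/-- The switch set `S_σ` of `σ`, computed with a best response `τ` to `σ`. -/
def switchSet (G : SSG V) (σ : G.MaxStrategy) (τ : G.MinStrategy) : Set V :=
  {x | x ∈ G.VMax ∧ ∃ y ∈ G.succ x, G.value σ τ x < G.value σ τ y}

/-- `σ'` is a `σ`-switch (w.r.t. a best response `τ` to `σ`). -/
def IsSwitch (G : SSG V) (σ : G.MaxStrategy) (τ : G.MinStrategy)
    (σ' : G.MaxStrategy) : Prop :=
  σ' ≠ σ ∧
  (∀ x ∈ G.VMax, x ∉ G.switchSet σ τ → σ'.toFun x = σ.toFun x) ∧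
  (∀ x ∈ G.switchSet σ τ, σ'.toFun x ≠ σ.toFun x →
    G.value σ τ x < G.value σ τ (σ'.toFun x))

/-- `σ` agrees with `σ₀` on `T`. -/
def AgreesOn (G : SSG V) (T : Set V) (σ₀ σ : G.MaxStrategy) : Prop :=
  ∀ x ∈ T, σ.toFun x = σ₀.toFun x

/-- `σ` is an optimal MAX strategy of the subgame `G_{|T[σ₀]}`: it agrees with `σ₀` on `T`
and its value vector dominates that of every MAX strategy of `G` agreeing with `σ₀` on `T`. -/
def IsOptimalOn (G : SSG V) (T : Set V) (σ₀ σ : G.MaxStrategy) : Prop :=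
  G.AgreesOn T σ₀ σ ∧
  ∀ σ' : G.MaxStrategy, G.AgreesOn T σ₀ σ' →
    ∀ τ τ' : G.MinStrategy, G.IsBestResponse σ τ → G.IsBestResponse σ' τ' →
      G.value σ' τ' ≤ G.value σ τ

/-- `σ'` is a `(σ,T)`-super-switch (w.r.t. a best response `τ` to `σ`): it is obtained from an
intermediate `σ`-switch `σ''` that only switches inside `T`, by taking an optimal strategy of
the subgame `G_{|T[σ'']}`. -/
def IsSuperSwitch (G : SSG V) (σ : G.MaxStrategy) (τ : G.MinStrategy)
    (T : Set V) (σ' : G.MaxStrategy) : Prop :=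
  ∃ σ'' : G.MaxStrategy, G.IsSwitch σ τ σ'' ∧
    (∀ x ∈ G.VMax, x ∉ T → σ''.toFun x = σ.toFun x) ∧
    G.IsOptimalOn T σ'' σ'

/-- A binary SSG: every MAX vertex has outdegree exactly 2. -/
def Binary (G : SSG V) : Prop := ∀ x ∈ G.VMax, (G.succ x).card = 2

/-- `σb` is the total switch `σ̄` of `σ` (in a binary SSG): it switches to the other
out-neighbour exactly on the switch set of `σ`. -/
def IsTotalSwitch (G : SSG V) (σ : G.MaxStrategy) (τ : G.MinStrategy)
    (σb : G.MaxStrategy) : Prop :=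
  (∀ x ∈ G.switchSet σ τ, σb.toFun x ≠ σ.toFun x) ∧
  (∀ x ∈ G.VMax, x ∉ G.switchSet σ τ → σb.toFun x = σ.toFun x)

end SSG

namespace SSG

variable {V : Type*} [Fintype V] [DecidableEq V]

theorem F_max (G : SSG V) (σ : G.MaxStrategy) (τ : G.MinStrategy) (w : V → unitInterval) {x : V}
    (h : x ∈ G.VMax) : G.F σ τ w x = w (σ.toFun x) := by simp [F, h]

theorem F_min (G : SSG V) (σ : G.MaxStrategy) (τ : G.MinStrategy) (w : V → unitInterval) {x : V}
    (h : x ∈ G.VMin) : G.F σ τ w x = w (τ.toFun x) := by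
  have h1 : x ∉ G.VMax := fun h' => Finset.disjoint_left.1 G.disjMaxMin h' h
  simp [F, h, h1]

theorem F_rand (G : SSG V) (σ : G.MaxStrategy) (τ : G.MinStrategy) (w : V → unitInterval) {x : V}
    (h : x ∈ G.VR) : (G.F σ τ w x : ℝ) = ∑ y, G.prob x y * (w y : ℝ) := by
  have h1 : x ∉ G.VMax := fun h' => Finset.disjoint_left.1 G.disjMaxR h' h
  have h2 : x ∉ G.VMin := fun h' => Finset.disjoint_left.1 G.disjMinR h' h
  simp [F, h, h1, h2]

theorem F_sink (G : SSG V) (σ : G.MaxStrategy) (τ : G.MinStrategy) (w : V → unitInterval) {x : V}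
    (h : x ∈ G.VS) : (G.F σ τ w x : ℝ) = G.val x := by
  have h1 : x ∉ G.VMax := fun h' => Finset.disjoint_left.1 G.disjMaxS h' h
  have h2 : x ∉ G.VMin := fun h' => Finset.disjoint_left.1 G.disjMinS h' h
  have h3 : x ∉ G.VR := fun h' => Finset.disjoint_left.1 G.disjRS h' h
  simp [F, h1, h2, h3]

/-- Comparison of two one-step operators, vertex by vertex. -/
theorem F_le_F (G : SSG V) (σ σ' : G.MaxStrategy) (τ τ' : G.MinStrategy) (w w' : V → unitInterval)
    (hw : w ≤ w')
    (hM : ∀ x ∈ G.VMax, w (σ.toFun x) ≤ w' (σ'.toFun x))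
    (hN : ∀ x ∈ G.VMin, w (τ.toFun x) ≤ w' (τ'.toFun x)) :
    G.F σ τ w ≤ G.F σ' τ' w' := by
  intro x
  rcases G.cover x with h | h | h | h
  · rw [F_max G _ _ _ h, F_max G _ _ _ h]; exact hM x h
  · rw [F_min G _ _ _ h, F_min G _ _ _ h]; exact hN x h
  · rw [← Subtype.coe_le_coe, F_rand G _ _ _ h, F_rand G _ _ _ h]
    exact Finset.sum_le_sum fun y _ =>
      mul_le_mul_of_nonneg_left (hw y) (G.prob_nonneg x y)
  · rw [← Subtype.coe_le_coe, F_sink G _ _ _ h, F_sink G _ _ _ h]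

theorem F_mono (G : SSG V) (σ : G.MaxStrategy) (τ : G.MinStrategy) {w w' : V → unitInterval}
    (hw : w ≤ w') : G.F σ τ w ≤ G.F σ τ w' :=
  F_le_F G σ σ τ τ w w' hw (fun _ _ => hw _) (fun _ _ => hw _)

theorem value_le (G : SSG V) (σ : G.MaxStrategy) (τ : G.MinStrategy) {w : V → unitInterval}
    (h : G.F σ τ w ≤ w) : G.value σ τ ≤ w := sInf_le h

theorem F_value (G : SSG V) (σ : G.MaxStrategy) (τ : G.MinStrategy) :
    G.F σ τ (G.value σ τ) = G.value σ τ := by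
  have h1 : G.F σ τ (G.value σ τ) ≤ G.value σ τ :=
    le_sInf fun w hw => (F_mono G σ τ (value_le G σ τ hw)).trans hw
  exact le_antisymm h1 (value_le G σ τ (F_mono G σ τ h1))

theorem exists_bestResponse (G : SSG V) (σ : G.MaxStrategy) :
    ∃ τ : G.MinStrategy, G.IsBestResponse σ τ := by
  classical
  set w : V → unitInterval := sInf {w | ∃ τ : G.MinStrategy, G.F σ τ w ≤ w} with hw
  have hex : ∀ x, ∃ z, (x ∈ G.VMin → z ∈ G.succ x ∧ ∀ y ∈ G.succ x, w z ≤ w y) ∧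
      (x ∉ G.VMin → z = x) := by
    intro x
    by_cases hx : x ∈ G.VMin
    · have hne : (G.succ x).Nonempty := Finset.card_pos.1 (by have := G.outMin x hx; omega)
      obtain ⟨z, hz, hz'⟩ := Finset.exists_min_image (G.succ x) w hne
      exact ⟨z, fun _ => ⟨hz, hz'⟩, fun h => absurd hx h⟩
    · exact ⟨x, fun h => absurd h hx, fun _ => rfl⟩
  choose t ht ht' using hex
  let τ : G.MinStrategy := ⟨t, fun x hx => (ht x hx).1, fun x hx => ht' x hx⟩
  refine ⟨τ, fun τ' => ?_⟩
  have h1 : G.F σ τ w ≤ w := by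
    refine le_sInf ?_
    rintro w' ⟨τ'', h⟩
    have hle : w ≤ w' := sInf_le ⟨τ'', h⟩
    refine le_trans ?_ h
    exact F_le_F G σ σ τ τ'' w w' hle (fun _ _ => hle _)
      (fun x hx => ((ht x hx).2 _ (τ''.mem_succ x hx)).trans (hle _))
  exact (value_le G σ τ h1).trans (sInf_le ⟨τ', (F_value G σ τ').le⟩)

theorem bestResponse_le_succ (G : SSG V) (σ : G.MaxStrategy) (τ : G.MinStrategy)
    (hbr : G.IsBestResponse σ τ) {x z : V} (hx : x ∈ G.VMin) (hz : z ∈ G.succ x) :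
    G.value σ τ x ≤ G.value σ τ z := by
  by_contra! hlt
  let τ' : G.MinStrategy := ⟨Function.update τ.toFun x z, by
      intro y hy
      by_cases h : y = x
      · subst h; simpa using hz
      · simpa [h] using τ.mem_succ y hy, by
      intro y hy
      have h : y ≠ x := by rintro rfl; exact hy hx
      simpa [h] using τ.eq_id y hy⟩
  have h1 : G.F σ τ' (G.value σ τ) ≤ G.value σ τ := by
    intro y
    by_cases h : y = x
    · subst h
      rw [F_min G _ _ _ hx]
      simpa [τ'] using hlt.le
    · conv_rhs => rw [← F_value]
      by_cases hy : y ∈ G.VMin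
      · rw [F_min G _ _ _ hy, F_min G _ _ _ hy]
        simp [τ', h]
      · simp [F, hy]
  have h2 := value_le G σ τ' h1
  have h3 : G.value σ τ' x = G.value σ τ' z := by
    conv_lhs => rw [← F_value, F_min G _ _ _ hx]
    simp [τ']
  have h4 := hbr τ' x
  rw [h3] at h4
  exact absurd (h4.trans (h2 z)) (not_le.2 hlt)

/-- Key lemma: improving `σ` weakly (strictly wherever it changes) improves the value. -/
theorem value_le_of_improve (G : SSG V) (σ σ' : G.MaxStrategy) (τ τ' : G.MinStrategy)
    (hbr : G.IsBestResponse σ τ)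
    (himp : ∀ x ∈ G.VMax, σ'.toFun x = σ.toFun x ∨
      G.value σ τ x < G.value σ τ (σ'.toFun x)) :
    G.value σ τ ≤ G.value σ' τ' := by
  classical
  set v := G.value σ τ with hv
  set u := G.value σ' τ' with hu
  by_contra hcon
  have hcon' : ∃ x, u x < v x := by
    by_contra! h
    exact hcon h
  obtain ⟨x0, hx0⟩ := hcon'
  obtain ⟨m, -, hm⟩ := Finset.exists_max_image Finset.univ (fun x => (v x : ℝ) - u x)
    ⟨x0, Finset.mem_univ _⟩
  have hm' : ∀ x, (v x : ℝ) - u x ≤ v m - u m := fun x => hm x (Finset.mem_univ _)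
  have hpos : (0:ℝ) < v m - u m := by
    have h1 := hm' x0
    have h2 : (u x0 : ℝ) < v x0 := hx0
    linarith
  set d : ℝ := v m - u m with hd
  have hvF : ∀ x, v x = G.F σ τ v x := fun x => by rw [hv, F_value]
  have huF : ∀ x, u x = G.F σ' τ' u x := fun x => by rw [hu, F_value]
  -- the zeroed vector
  let w : V → unitInterval := fun x => if (v x : ℝ) - u x = d then 0 else G.value σ τ' x
  have hwle : w ≤ G.value σ τ' := by
    intro x
    by_cases h : (v x : ℝ) - u x = d
    · simp only [w, h, if_true]; exact (G.value σ τ' x).2.1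
    · simp [w, h]
  have hw0 : ∀ x, (v x : ℝ) - u x = d → w x = 0 := fun x h => by simp [w, h]
  have hFw : G.F σ τ' w ≤ w := by
    intro x
    by_cases h : (v x : ℝ) - u x = d
    · rw [hw0 x h]
      refine le_of_eq ?_
      rcases G.cover x with hx | hx | hx | hx
      · rw [F_max G _ _ _ hx]
        apply hw0
        have e1 : u x = u (σ'.toFun x) := by rw [huF x, F_max G _ _ _ hx]
        have e2 : v x = v (σ.toFun x) := by rw [hvF x, F_max G _ _ _ hx]
        rcases himp x hx with h' | h'
        · rw [← e2, ← h', ← e1]; exact h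
        · have h1 := hm' (σ'.toFun x)
          have h2 : (v x : ℝ) < v (σ'.toFun x) := h'
          rw [← e1] at h1
          linarith
      · rw [F_min G _ _ _ hx]
        apply hw0
        have e1 : u x = u (τ'.toFun x) := by rw [huF x, F_min G _ _ _ hx]
        have h2 : (v x : ℝ) ≤ v (τ'.toFun x) :=
          bestResponse_le_succ G σ τ hbr hx (τ'.mem_succ x hx)
        have h1 := hm' (τ'.toFun x)
        rw [← e1] at h1 ⊢
        linarith
      · apply Subtype.ext
        rw [F_rand G _ _ _ hx]
        have e1 : (u x : ℝ) = ∑ y, G.prob x y * (u y : ℝ) := by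
          rw [huF x, F_rand G _ _ _ hx]
        have e2 : (v x : ℝ) = ∑ y, G.prob x y * (v y : ℝ) := by
          rw [hvF x, F_rand G _ _ _ hx]
        have e3 : ∑ y, G.prob x y * (d - ((v y : ℝ) - u y)) = 0 := by
          have : ∑ y, G.prob x y * (d - ((v y : ℝ) - u y)) =
              (∑ y, G.prob x y) * d - (∑ y, G.prob x y * (v y : ℝ)
                - ∑ y, G.prob x y * (u y : ℝ)) := by
            rw [Finset.sum_mul, ← Finset.sum_sub_distrib, ← Finset.sum_sub_distrib]
            exact Finset.sum_congr rfl fun y _ => by ring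
          rw [this, G.prob_sum x hx, ← e1, ← e2, h]; ring
        have e4 := (Finset.sum_eq_zero_iff_of_nonneg (fun y _ =>
          mul_nonneg (G.prob_nonneg x y) (sub_nonneg.2 (hm' y)))).1 e3
        refine Finset.sum_eq_zero fun y hy => ?_
        rcases mul_eq_zero.1 (e4 y hy) with h' | h'
        · rw [h', zero_mul]
        · rw [hw0 y (by linarith)]; simp
      · exfalso
        have e1 : (u x : ℝ) = G.val x := by rw [huF x, F_sink G _ _ _ hx]
        have e2 : (v x : ℝ) = G.val x := by rw [hvF x, F_sink G _ _ _ hx]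
        linarith
    · have h1 : w x = G.value σ τ' x := by simp [w, h]
      rw [h1]
      exact (F_mono G σ τ' hwle x).trans ((F_value G σ τ').le x)
  have h1 : (v m : ℝ) ≤ w m := (hbr τ' m).trans (value_le G σ τ' hFw m)
  rw [hw0 m rfl] at h1
  have h2 : (0:ℝ) ≤ u m := (u m).2.1
  have h3 : ((0 : unitInterval) : ℝ) = 0 := rfl
  linarith

end SSG

/-- a MAX strategy is optimal iff its switch set is empty. -/
theorem optimal_iff_switchSet_empty {V : Type*} [Fintype V] [DecidableEq V] (G : SSG V)
    (σ : G.MaxStrategy) (τ : G.MinStrategy) (hbr : G.IsBestResponse σ τ) :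
    G.IsOptimal σ ↔ G.switchSet σ τ = ∅ := by
  constructor
  · intro hopt
    by_contra hne
    obtain ⟨x, hx, y, hy, hlt⟩ := Set.nonempty_iff_ne_empty.2 hne
    let σ' : G.MaxStrategy := ⟨Function.update σ.toFun x y, by
        intro z hz
        by_cases h : z = x
        · subst h; simpa using hy
        · simpa [h] using σ.mem_succ z hz, by
        intro z hz
        have h : z ≠ x := by rintro rfl; exact hz hx
        simpa [h] using σ.eq_id z hz⟩
    obtain ⟨τ', hτ'⟩ := SSG.exists_bestResponse G σ'
    have h1 := SSG.value_le_of_improve G σ σ' τ τ' hbr (by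
      intro z hz
      by_cases h : z = x
      · subst h; right; simpa [σ'] using hlt
      · left; simp [σ', h])
    have h2 := hopt τ hbr σ' τ' hτ' x
    have h3 : G.value σ' τ' x = G.value σ' τ' y := by
      conv_lhs => rw [← SSG.F_value, SSG.F_max G _ _ _ hx]
      simp [σ']
    rw [h3] at h2
    exact absurd ((h1 y).trans h2) (not_le.2 hlt)
  · intro hS τ₁ h₁ σ' τ' hτ'
    refine (hτ' τ).trans (le_trans ?_ (hbr τ₁))
    apply SSG.value_le
    refine le_trans (SSG.F_le_F G σ' σ τ τ _ _ le_rfl ?_ fun _ _ => le_rfl)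
      (SSG.F_value G σ τ).le
    intro x hx
    have e : G.value σ τ (σ.toFun x) = G.value σ τ x := by
      conv_rhs => rw [← SSG.F_value, SSG.F_max G _ _ _ hx]
    rw [e]
    by_contra! hlt
    have : x ∈ G.switchSet σ τ := ⟨hx, _, σ'.mem_succ x hx, hlt⟩
    rw [hS] at this
    exact this
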